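/- arXiv:2604.28006 — 9 statements merged into one kernel-verified Lean document; each statement's English description precedes it below -/
import Mathlib

section
/- (O(1/t) primal convergence of Frank–Wolfe) Running the Frank–Wolfe algorithm with any one of the three step-size rules — the short-step rule γ_t = min{g_t/(L d_t²), 1}, exact line search γ_t ∈ argmin_{γ∈[0,1]} f(x_t + γ(s_t − x_t)), or the classical open-loop rule γ_t = 2/(t+2) — the iterates satisfy F_t ≤ 2LD²/(t+2) for all t ≥ 1; in particular F_t → 0. -/
open scoped RealInnerProductSpace
open Filter

/-- First-order characterisation of convexity: a convex function lies above its tangents. -/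
lemma ConvexOn.add_inner_gradient_le {E : Type*} [NormedAddCommGroup E] [InnerProductSpace ℝ E]
    [CompleteSpace E] {f : E → ℝ} {g x : E} (hf : ConvexOn ℝ Set.univ f)
    (hg : HasGradientAt f g x) (y : E) : f x + ⟪g, y - x⟫ ≤ f y := by
  have hline : HasDerivAt (fun t : ℝ => f (x + t • (y - x))) ⟪g, y - x⟫ 0 := by
    simpa [HasLineDerivAt] using hg.hasFDerivAt.hasLineDerivAt (y - x)
  have hconv : ConvexOn ℝ Set.univ (fun t : ℝ => f (x + t • (y - x))) := by
    have h := hf.comp_affineMap (AffineMap.lineMap (k := ℝ) x y)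
    rw [Set.preimage_univ] at h
    simpa [Function.comp_def, AffineMap.lineMap_apply, add_comm] using h
  have h := hconv.le_slope_of_hasDerivAt (Set.mem_univ 0) (Set.mem_univ 1) one_pos hline
  simp only [slope_def_field, one_smul, zero_smul, add_zero, sub_zero, div_one,
    add_sub_cancel] at h
  linarith

/-- The clipped ratio `min (g / a) 1` minimises `γ ↦ -γ g + γ² a / 2` over `[0, 1]`. -/
lemma neg_mul_add_sq_min_div_one_le {g a η : ℝ} (ha : 0 ≤ a) (hga : a = 0 → g = 0)
    (hη : η ∈ Set.Icc (0 : ℝ) 1) :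
    -(min (g / a) 1 * g) + min (g / a) 1 ^ 2 * (a / 2) ≤ -(η * g) + η ^ 2 * (a / 2) := by
  obtain ⟨h0, h1⟩ := hη
  rcases ha.eq_or_lt with rfl | hpos
  · simp [hga rfl]
  rcases le_total (g / a) 1 with h | h
  · rw [min_eq_left h]
    obtain ⟨r, rfl⟩ : ∃ r, g = r * a := ⟨g / a, by field_simp⟩
    rw [mul_div_cancel_right₀ _ hpos.ne']
    nlinarith [mul_nonneg ha (sq_nonneg (η - r))]
  · rw [min_eq_right h]
    have hag : a ≤ g := (one_le_div₀ hpos).1 h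
    nlinarith [mul_nonneg (sub_nonneg.2 h1) (sub_nonneg.2 hag),
      mul_nonneg ha (sq_nonneg (1 - η))]

/-- The recursion `F (t + 1) ≤ (1 - η) F t + η² M / 4` with `η = 2 / (t + 2)` forces
`F t ≤ M / (t + 2)` from the first step on. -/
lemma le_div_add_two_of_openLoop_recursion {F : ℕ → ℝ} {M : ℝ} (hM : 0 ≤ M)
    (hF : ∀ t : ℕ, F (t + 1) ≤
      (1 - 2 / ((t : ℝ) + 2)) * F t + (2 / ((t : ℝ) + 2)) ^ 2 * (M / 4))
    (t : ℕ) (ht : 1 ≤ t) : F t ≤ M / ((t : ℝ) + 2) := by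
  induction t, ht using Nat.le_induction with
  | base =>
    have h := hF 0
    norm_num at h ⊢
    linarith
  | succ t _ ih =>
    have hη : 0 ≤ 1 - 2 / ((t : ℝ) + 2) := by
      rw [sub_nonneg, div_le_one (by positivity)]
      linarith [(Nat.cast_nonneg t : (0 : ℝ) ≤ t)]
    calc F (t + 1)
        ≤ (1 - 2 / ((t : ℝ) + 2)) * (M / ((t : ℝ) + 2))
            + (2 / ((t : ℝ) + 2)) ^ 2 * (M / 4) :=
          (hF t).trans (by gcongr)
      _ = M * ((t + 1) / ((t : ℝ) + 2) ^ 2) := by field_simp; ring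
      _ ≤ M * (1 / ((t : ℝ) + 3)) := by
          refine mul_le_mul_of_nonneg_left ?_ hM
          rw [div_le_div_iff₀ (by positivity) (by positivity)]
          nlinarith
      _ = M / (((t + 1 : ℕ) : ℝ) + 2) := by push_cast; ring

/-- **O(1/t) primal convergence of Frank–Wolfe.**
Running Frank–Wolfe with the short-step rule, exact line search, or the classical
open-loop rule `γ_t = 2/(t+2)`, the iterates satisfy `F_t ≤ 2 L D² / (t+2)` for all
`t ≥ 1`; in particular `F_t → 0`. -/
theorem frankWolfe_primal_convergence
    {d : ℕ} {C : Set (EuclideanSpace ℝ (Fin d))}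
    (hCne : C.Nonempty) (hCcomp : IsCompact C) (hCconv : Convex ℝ C)
    {f : EuclideanSpace ℝ (Fin d) → ℝ}
    {f' : EuclideanSpace ℝ (Fin d) → EuclideanSpace ℝ (Fin d)}
    (hfconv : ConvexOn ℝ Set.univ f)
    (hgrad : ∀ y, HasGradientAt f (f' y) y)
    {L : ℝ} (hL : 0 < L)
    (hsmooth : ∀ x ∈ C, ∀ y ∈ C,
      f y ≤ f x + ⟪f' x, y - x⟫ + L / 2 * ‖y - x‖ ^ 2)
    {fstar : ℝ} (hfstar : IsLeast (f '' C) fstar)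
    {D : ℝ} (hD : IsGreatest {r : ℝ | ∃ y ∈ C, ∃ z ∈ C, r = ‖y - z‖} D)
    {x s : ℕ → EuclideanSpace ℝ (Fin d)} {γ : ℕ → ℝ}
    (hx0 : x 0 ∈ C)
    (hatom : ∀ t, s t ∈ C ∧ ∀ y ∈ C, ⟪f' (x t), s t⟫ ≤ ⟪f' (x t), y⟫)
    (hupd : ∀ t, x (t + 1) = x t + γ t • (s t - x t))
    (hrule :
      (∀ t, γ t =
          min (⟪f' (x t), x t - s t⟫ / (L * ‖x t - s t‖ ^ 2)) 1)
      ∨ (∀ t, γ t ∈ Set.Icc (0 : ℝ) 1 ∧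
          ∀ γ' ∈ Set.Icc (0 : ℝ) 1,
            f (x t + γ t • (s t - x t)) ≤ f (x t + γ' • (s t - x t)))
      ∨ (∀ t, γ t = 2 / ((t : ℝ) + 2))) :
    (∀ t : ℕ, 1 ≤ t → f (x t) - fstar ≤ 2 * L * D ^ 2 / ((t : ℝ) + 2))
    ∧ Tendsto (fun t => f (x t) - fstar) atTop (nhds 0) := by
  have hη : ∀ t : ℕ, 2 / ((t : ℝ) + 2) ∈ Set.Icc (0 : ℝ) 1 := fun t =>
    ⟨by positivity, by
      rw [div_le_one (by positivity)]
      linarith [(Nat.cast_nonneg t : (0 : ℝ) ≤ t)]⟩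
  have hγ : ∀ t, x t ∈ C → γ t ∈ Set.Icc (0 : ℝ) 1 := by
    intro t hx
    rcases hrule with h | h | h
    · rw [h t]
      have hg : 0 ≤ ⟪f' (x t), x t - s t⟫ := by
        rw [inner_sub_right]
        linarith [(hatom t).2 _ hx]
      exact ⟨le_min (by positivity) zero_le_one, min_le_right _ _⟩
    · exact (h t).1
    · exact h t ▸ hη t
  have hmem : ∀ t, x t ∈ C → ∀ η ∈ Set.Icc (0 : ℝ) 1, x t + η • (s t - x t) ∈ C :=
    fun t hx η hη => hCconv.add_smul_sub_mem hx (hatom t).1 hη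
  have hxC : ∀ t, x t ∈ C := by
    intro t
    induction t with
    | zero => exact hx0
    | succ t ih => exact hupd t ▸ hmem t ih _ (hγ t ih)
  have hdescent : ∀ t, ∀ η ∈ Set.Icc (0 : ℝ) 1, f (x t + η • (s t - x t)) ≤
      f (x t) + (-(η * ⟪f' (x t), x t - s t⟫) + η ^ 2 * (L * ‖x t - s t‖ ^ 2 / 2)) := by
    intro t η hη
    have h := hsmooth _ (hxC t) _ (hmem t (hxC t) η hη)
    rw [add_sub_cancel_left, inner_smul_right, norm_smul, mul_pow, Real.norm_eq_abs, sq_abs,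
      ← neg_sub (x t) (s t), inner_neg_right, norm_neg] at h
    rw [← neg_sub (x t) (s t)]
    linarith
  have hstep : ∀ t : ℕ, f (x (t + 1)) ≤ f (x t) +
      (-(2 / ((t : ℝ) + 2) * ⟪f' (x t), x t - s t⟫)
        + (2 / ((t : ℝ) + 2)) ^ 2 * (L * ‖x t - s t‖ ^ 2 / 2)) := by
    intro t
    rw [hupd t]
    rcases hrule with h | h | h
    · refine (hdescent t _ (hγ t (hxC t))).trans ?_
      rw [h t]
      refine add_le_add_right ?_ _
      refine neg_mul_add_sq_min_div_one_le (by positivity) (fun h0 => ?_) (hη t)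
      have h0 : x t - s t = 0 := by simpa [hL.ne'] using h0
      simp [h0]
    · exact ((h t).2 _ (hη t)).trans (hdescent t _ (hη t))
    · rw [h t]
      exact hdescent t _ (hη t)
  obtain ⟨⟨z, hz, hfz⟩, hmin⟩ := hfstar
  have hprimal : ∀ t, f (x t) - fstar ≤ ⟪f' (x t), x t - s t⟫ := by
    intro t
    have h1 := hfconv.add_inner_gradient_le (hgrad (x t)) z
    have h2 := (hatom t).2 z hz
    rw [inner_sub_right] at h1 ⊢
    linarith
  have hdiam : ∀ t, ‖x t - s t‖ ^ 2 ≤ D ^ 2 := fun t =>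
    pow_le_pow_left₀ (norm_nonneg _) (hD.2 ⟨_, hxC t, _, (hatom t).1, rfl⟩) 2
  have hrate : ∀ t : ℕ, 1 ≤ t → f (x t) - fstar ≤ 2 * L * D ^ 2 / ((t : ℝ) + 2) := by
    refine le_div_add_two_of_openLoop_recursion (F := fun t => f (x t) - fstar)
      (by positivity) (fun t => ?_)
    have h1 := mul_le_mul_of_nonneg_left (hprimal t) (hη t).1
    have h2 := mul_le_mul_of_nonneg_left (mul_le_mul_of_nonneg_left (hdiam t) hL.le)
      (sq_nonneg (2 / ((t : ℝ) + 2)))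
    linarith [hstep t]
  refine ⟨hrate, squeeze_zero' (g := fun t : ℕ => 2 * L * D ^ 2 / ((t : ℝ) + 2))
    (.of_forall fun t => sub_nonneg.2 (hmin ⟨_, hxC t, rfl⟩))
    (eventually_atTop.2 ⟨1, hrate⟩) ?_⟩
  exact (tendsto_natCast_atTop_atTop.atTop_add tendsto_const_nhds).const_div_atTop _
end

section
/- (Discrete power-law descent) Let (a_t) be a nonnegative real sequence. Assume there exist constants 0 < η ≤ 1, 0 < r ≤ 1 and an index t_0 ∈ ℕ with a_{t_0} ≤ 1 such that a_{t+1} ≤ a_t − η a_t^{1+r} for all t ≥ t_0. Then a_t = O(t^{−1/r}), i.e., there exists a constant K > 0 such that a_t ≤ K t^{−1/r} for all t ≥ 1. -/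
open Filter

/-- One step of the descent recursion, in terms of the `r`-th powers. -/
theorem rpow_descent_step {x y η r : ℝ} (hx : 0 ≤ x) (hy : 0 ≤ y) (hx1 : x ^ r ≤ 1)
    (hη1 : η ≤ 1) (hr0 : 0 < r) (hr1 : r ≤ 1)
    (h : y ≤ x - η * x ^ (1 + r)) :
    y ^ r ≤ x ^ r * (1 - r * η * x ^ r) := by
  have hb : 0 ≤ x ^ r := Real.rpow_nonneg hx r
  have hηb : η * x ^ r ≤ 1 := mul_le_one₀ hη1 hb hx1
  have hxr : x ^ (1 + r) = x * x ^ r := by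
    rw [Real.rpow_add_of_nonneg hx zero_le_one hr0.le, Real.rpow_one]
  have hfac : y ≤ x * (1 + -(η * x ^ r)) := by
    rw [hxr] at h
    linarith
  calc y ^ r ≤ (x * (1 + -(η * x ^ r))) ^ r := Real.rpow_le_rpow hy hfac hr0.le
    _ = x ^ r * (1 + -(η * x ^ r)) ^ r := Real.mul_rpow hx (by linarith)
    _ ≤ x ^ r * (1 + r * -(η * x ^ r)) := by
        gcongr
        exact rpow_one_add_le_one_add_mul_self (by linarith) hr0.le hr1
    _ = x ^ r * (1 - r * η * x ^ r) := by ring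

/-- A discrete logistic inequality keeps `b * M ≤ 1` while `M` grows by `c`. -/
theorem logistic_step {b b' c M : ℝ} (hb0 : 0 ≤ b) (hb1 : b ≤ 1) (hc0 : 0 ≤ c) (hc1 : c ≤ 1)
    (hM : 0 ≤ M) (hbM : b * M ≤ 1) (h : b' ≤ b * (1 - c * b)) : b' * (M + c) ≤ 1 := by
  have hcb : c * b ≤ 1 := mul_le_one₀ hc1 hb0 hb1
  calc b' * (M + c) ≤ b * (1 - c * b) * (M + c) := by gcongr
    _ = (1 - c * b) * (b * M + c * b) := by ring
    _ ≤ (1 - c * b) * (1 + c * b) := by gcongr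
    _ ≤ 1 := by nlinarith [sq_nonneg (c * b)]

/-- The `r`-th powers decay at least as fast as `1 / (1 + n r η)`. -/
theorem rpow_descent_bound {a : ℕ → ℝ} (hnn : ∀ t, 0 ≤ a t) {η r : ℝ} (hη0 : 0 < η)
    (hη1 : η ≤ 1) (hr0 : 0 < r) (hr1 : r ≤ 1) {t0 : ℕ} (ha0 : a t0 ≤ 1)
    (hrec : ∀ t, t0 ≤ t → a (t + 1) ≤ a t - η * a t ^ (1 + r)) (n : ℕ) :
    a (t0 + n) ^ r * (1 + n * (r * η)) ≤ 1 := by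
  induction n with
  | zero => simpa using Real.rpow_le_one (hnn t0) ha0 hr0.le
  | succ n ih =>
    have hc : 0 ≤ r * η := by positivity
    have hb0 : 0 ≤ a (t0 + n) ^ r := Real.rpow_nonneg (hnn _) r
    have hb1 : a (t0 + n) ^ r ≤ 1 := by
      nlinarith [mul_nonneg hb0 (mul_nonneg n.cast_nonneg hc)]
    have hstep := rpow_descent_step (hnn _) (hnn _) hb1 hη1 hr0 hr1
      (hrec (t0 + n) (by lia))
    have := logistic_step hb0 hb1 hc (mul_le_one₀ hr1 hη0.le hη1) (by positivity) ih hstep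
    calc a (t0 + (n + 1)) ^ r * (1 + ((n + 1 : ℕ) : ℝ) * (r * η))
        = a (t0 + n + 1) ^ r * (1 + n * (r * η) + r * η) := by
          rw [← add_assoc]; push_cast; ring
      _ ≤ 1 := this

/-- **Discrete power-law descent.**
If a nonnegative sequence satisfies `a_{t+1} ≤ a_t - η a_t^{1+r}` for all `t ≥ t_0`
with `0 < η ≤ 1`, `0 < r ≤ 1`, and `a_{t_0} ≤ 1`, then `a_t = O(t^{-1/r})`. -/
theorem discrete_power_law_descent
    {a : ℕ → ℝ} (hnn : ∀ t, 0 ≤ a t)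
    {η r : ℝ} (hη0 : 0 < η) (hη1 : η ≤ 1) (hr0 : 0 < r) (hr1 : r ≤ 1)
    {t0 : ℕ} (ha0 : a t0 ≤ 1)
    (hrec : ∀ t, t0 ≤ t → a (t + 1) ≤ a t - η * a t ^ (1 + r)) :
    ∃ K > 0, ∀ t : ℕ, 1 ≤ t → a t ≤ K * (t : ℝ) ^ (-(1 / r)) := by
  have hc0 : 0 < r * η := by positivity
  have hc1 : r * η ≤ 1 := mul_le_one₀ hr1 hη0.le hη1
  set C : ℝ := (1 + t0) / (r * η) with hC
  have hC0 : 0 < C := by positivity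
  have hterm (s : ℕ) : 0 ≤ a s * (s : ℝ) ^ (1 / r) :=
    mul_nonneg (hnn s) (Real.rpow_nonneg s.cast_nonneg _)
  have hsum : 0 ≤ ∑ s ∈ Finset.range t0, a s * (s : ℝ) ^ (1 / r) :=
    Finset.sum_nonneg fun s _ => hterm s
  have hCr : 0 < C ^ (1 / r) := Real.rpow_pos_of_pos hC0 _
  refine ⟨C ^ (1 / r) + ∑ s ∈ Finset.range t0, a s * (s : ℝ) ^ (1 / r), by linarith,
    fun t ht => ?_⟩
  have ht0 : (0 : ℝ) < t := by exact_mod_cast ht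
  rw [Real.rpow_neg ht0.le, ← div_eq_mul_inv, le_div_iff₀ (Real.rpow_pos_of_pos ht0 _)]
  rcases lt_or_ge t t0 with hlt | hge
  · have := Finset.single_le_sum (fun s _ => hterm s) (Finset.mem_range.mpr hlt)
    linarith
  · obtain ⟨n, rfl⟩ := Nat.exists_eq_add_of_le hge
    have hbound := rpow_descent_bound hnn hη0 hη1 hr0 hr1 ha0 hrec n
    have hb0 : 0 ≤ a (t0 + n) ^ r := Real.rpow_nonneg (hnn _) r
    have hgrowth : ((t0 + n : ℕ) : ℝ) * (r * η) ≤ (1 + t0) * (1 + n * (r * η)) := by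
      have h1 : (t0 : ℝ) * (r * η) ≤ t0 := mul_le_of_le_one_right t0.cast_nonneg hc1
      have h2 : 0 ≤ (t0 : ℝ) * (n * (r * η)) := by positivity
      push_cast
      linarith
    have hpow : a (t0 + n) ^ r * ((t0 + n : ℕ) : ℝ) ≤ C := by
      rw [hC, le_div_iff₀ hc0]
      calc a (t0 + n) ^ r * ((t0 + n : ℕ) : ℝ) * (r * η)
          = a (t0 + n) ^ r * (((t0 + n : ℕ) : ℝ) * (r * η)) := by ring
        _ ≤ a (t0 + n) ^ r * ((1 + t0) * (1 + n * (r * η))) := by gcongr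
        _ = (1 + t0) * (a (t0 + n) ^ r * (1 + n * (r * η))) := by ring
        _ ≤ (1 + t0) * 1 := by gcongr
        _ = 1 + t0 := mul_one _
    calc a (t0 + n) * ((t0 + n : ℕ) : ℝ) ^ (1 / r)
        = (a (t0 + n) ^ r * ((t0 + n : ℕ) : ℝ)) ^ (1 / r) := by
          rw [Real.mul_rpow hb0 ht0.le, ← Real.rpow_mul (hnn _), mul_one_div_cancel hr0.ne',
            Real.rpow_one]
      _ ≤ C ^ (1 / r) := Real.rpow_le_rpow (by positivity) hpow (by positivity)
      _ ≤ _ := le_add_of_nonneg_right hsum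
end

section
/- (Uniformly-convex geometric gap bound) Let C be (α, q)-uniformly convex, let x ∈ C, let g ∈ ℝ^d, and let s ∈ argmin_{y∈C} ⟨g, y⟩. Then (α/2)·‖g‖·‖x − s‖^q ≤ ⟨g, x − s⟩. -/
open scoped RealInnerProductSpace

/-- **Uniformly-convex geometric gap bound.**
If `C` is `(α,q)`-uniformly convex, `x ∈ C`, and `s ∈ argmin_{y∈C} ⟪g, y⟫`, then
`(α/2) ‖g‖ ‖x - s‖^q ≤ ⟪g, x - s⟫`. -/
theorem uniformly_convex_gap_bound
    {d : ℕ} {C : Set (EuclideanSpace ℝ (Fin d))}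
    {α q : ℝ} (hα : 0 < α) (hq : 2 ≤ q)
    (hUC : ∀ x ∈ C, ∀ y ∈ C, ∀ lam ∈ Set.Icc (0 : ℝ) 1,
      ∀ z : EuclideanSpace ℝ (Fin d), ‖z‖ = 1 →
        lam • x + (1 - lam) • y + (lam * (1 - lam) * α * ‖x - y‖ ^ q) • z ∈ C)
    {x s : EuclideanSpace ℝ (Fin d)} {g : EuclideanSpace ℝ (Fin d)}
    (hx : x ∈ C) (hsC : s ∈ C)
    (hsmin : ∀ y ∈ C, ⟪g, s⟫ ≤ ⟪g, y⟫) :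
    α / 2 * ‖g‖ * ‖x - s‖ ^ q ≤ ⟪g, x - s⟫ := by
  rcases eq_or_ne g 0 with rfl | hg
  · simp
  have hg' : ‖g‖ ≠ 0 := norm_ne_zero_iff.mpr hg
  have hz : ‖-(‖g‖⁻¹ • g)‖ = 1 := by
    rw [norm_neg, norm_smul, norm_inv, norm_norm, inv_mul_cancel₀ hg']
  have hgz : ⟪g, -(‖g‖⁻¹ • g)⟫ = -‖g‖ := by
    rw [inner_neg_right, real_inner_smul_right, real_inner_self_eq_norm_sq]
    field_simp
  have h := hsmin _ (hUC x hx s hsC (1 / 2) ⟨by norm_num, by norm_num⟩ _ hz)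
  rw [inner_add_right, inner_add_right, real_inner_smul_right, real_inner_smul_right,
    real_inner_smul_right, hgz] at h
  rw [inner_sub_right]
  linarith
end

section
/- (Uniform convexity implies local dual sharpness) If C is (α, q)-uniformly convex, then for every nonempty M ⊆ C, any linear minimization oracle for C with any fixed atom-selection rule satisfies local dual sharpness around M with constants (α/2, q); in fact, the inequality (α/2)‖g‖‖x−s‖^q ≤ ⟨g, x−s⟩ holds for all x ∈ C (so any ρ > 0, e.g. ρ = 1, works in the definition). -/
open scoped RealInnerProductSpace

/-- A minimizer `s` of the linear functional `⟪g, ·⟫` over a uniformly convex set is sharp: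
the functional grows at least like `(α / 2) * ‖g‖ * ‖x - s‖ ^ q` away from `s`. -/
theorem norm_mul_rpow_le_inner_sub_of_uniformlyConvex
    {E : Type*} [NormedAddCommGroup E] [InnerProductSpace ℝ E] {C : Set E} {α q : ℝ}
    (hUC : ∀ x ∈ C, ∀ y ∈ C, ∀ lam ∈ Set.Icc (0 : ℝ) 1, ∀ z : E, ‖z‖ = 1 →
      lam • x + (1 - lam) • y + (lam * (1 - lam) * α * ‖x - y‖ ^ q) • z ∈ C)
    {g s x : E} (hs : s ∈ C) (hmin : ∀ y ∈ C, ⟪g, s⟫ ≤ ⟪g, y⟫) (hx : x ∈ C) :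
    α / 2 * ‖g‖ * ‖x - s‖ ^ q ≤ ⟪g, x - s⟫ := by
  rcases eq_or_ne g 0 with rfl | hg
  · simp
  have hg' : ‖g‖ ≠ 0 := norm_ne_zero_iff.mpr hg
  have hz : ‖-(‖g‖⁻¹ • g)‖ = 1 := by
    rw [norm_neg, norm_smul, norm_inv, norm_norm, inv_mul_cancel₀ hg']
  have hgz : ⟪g, -(‖g‖⁻¹ • g)⟫ = -‖g‖ := by
    rw [inner_neg_right, real_inner_smul_right, real_inner_self_eq_norm_mul_norm,
      inv_mul_cancel_left₀ hg']
  have h := hmin _ (hUC x hx s hs (1 / 2) ⟨by norm_num, by norm_num⟩ _ hz)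
  rw [inner_add_right, inner_add_right, real_inner_smul_right, real_inner_smul_right,
    real_inner_smul_right, hgz] at h
  rw [inner_sub_right]
  linarith

/-- **Uniform convexity implies local dual sharpness.**
If `C` is `(α,q)`-uniformly convex, then for every nonempty `M ⊆ C` and any fixed
LMO atom-selection rule, local dual sharpness around `M` holds with constants
`(α/2, q)`; in fact the inequality holds for all `x ∈ C`, so any `ρ > 0` works. -/
theorem uniform_convexity_implies_local_dual_sharpness
    {d : ℕ} {C : Set (EuclideanSpace ℝ (Fin d))}
    {α q : ℝ} (hα : 0 < α) (hq : 2 ≤ q)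
    (hUC : ∀ x ∈ C, ∀ y ∈ C, ∀ lam ∈ Set.Icc (0 : ℝ) 1,
      ∀ z : EuclideanSpace ℝ (Fin d), ‖z‖ = 1 →
        lam • x + (1 - lam) • y + (lam * (1 - lam) * α * ‖x - y‖ ^ q) • z ∈ C)
    {M : Set (EuclideanSpace ℝ (Fin d))} (hMne : M.Nonempty) (hMC : M ⊆ C)
    {lmo : EuclideanSpace ℝ (Fin d) → EuclideanSpace ℝ (Fin d)}
    (hlmo : ∀ g, lmo g ∈ C ∧ ∀ y ∈ C, ⟪g, lmo g⟫ ≤ ⟪g, y⟫) :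
    (∀ x ∈ C, ∀ g : EuclideanSpace ℝ (Fin d),
      α / 2 * ‖g‖ * ‖x - lmo g‖ ^ q ≤ ⟪g, x - lmo g⟫)
    ∧
    (∃ ρ > (0 : ℝ), ∀ x ∈ C, Metric.infDist x M < ρ →
      ∀ g : EuclideanSpace ℝ (Fin d),
        α / 2 * ‖g‖ * ‖x - lmo g‖ ^ q ≤ ⟪g, x - lmo g⟫) := by
  have sharp : ∀ x ∈ C, ∀ g : EuclideanSpace ℝ (Fin d),
      α / 2 * ‖g‖ * ‖x - lmo g‖ ^ q ≤ ⟪g, x - lmo g⟫ := fun x hx g =>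
    norm_mul_rpow_le_inner_sub_of_uniformlyConvex hUC (hlmo g).1 (hlmo g).2 hx
  exact ⟨sharp, 1, one_pos, fun x hx _ => sharp x hx⟩
end

section
/- (LDS + short steps or exact line search, conditional form) Let M ⊆ C be nonempty, and assume the Frank–Wolfe iterates (x_t) are generated either by the short-step rule γ_t = min{g_t/(L d_t²), 1} or by exact line search γ_t ∈ argmin_{γ∈[0,1]} f(x_t + γ(s_t − x_t)). Suppose C together with its LMO satisfies local dual sharpness around M with some constants (A, q). Let x* ∈ C, and let (p_t) ⊆ M satisfy f(p_t) = f(x*) and ∇f(p_t) = 0 for all t. If δ_t := ‖x_t − p_t‖ → 0, then (t+2)(f(x_t) − f(x*)) → 0. -/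
open scoped RealInnerProductSpace
open Filter

/-- First-order lower bound of a convex function by its tangent plane. -/
theorem ConvexOn.add_inner_le_of_hasGradientAt {E : Type*} [NormedAddCommGroup E]
    [InnerProductSpace ℝ E] [CompleteSpace E] {f : E → ℝ} (hf : ConvexOn ℝ Set.univ f)
    {x g : E} (hg : HasGradientAt f g x) (y : E) : f x + ⟪g, y - x⟫ ≤ f y := by
  have hconv : ConvexOn ℝ Set.univ (fun r : ℝ => f (AffineMap.lineMap x y r)) :=
    hf.comp_affineMap (AffineMap.lineMap x y)
  have hderiv : HasDerivAt (fun r : ℝ => f (AffineMap.lineMap x y r)) ⟪g, y - x⟫ 0 := by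
    have hline : HasDerivAt (fun r : ℝ => AffineMap.lineMap x y r) (y - x) (0 : ℝ) :=
      AffineMap.hasDerivAt_lineMap
    have hfd : HasFDerivAt f (InnerProductSpace.toDual ℝ E g)
        (AffineMap.lineMap x y (0 : ℝ)) := by
      simpa using hg.hasFDerivAt
    rw [← InnerProductSpace.toDual_apply_apply (𝕜 := ℝ)]
    exact hfd.comp_hasDerivAt (0 : ℝ) hline
  have hslope := hconv.le_slope_of_hasDerivAt (Set.mem_univ 0) (Set.mem_univ 1) one_pos hderiv
  simp only [slope_def_field, AffineMap.lineMap_apply_one, AffineMap.lineMap_apply_zero,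
    sub_zero, div_one] at hslope
  linarith

/-- The decrease guaranteed by minimizing the quadratic upper model `a - r * g + L / 2 * r ^ 2 * D`
over step sizes `r ∈ [0, 1]`. -/
theorem quadratic_model_decrease {L D g a b : ℝ} (hL : 0 < L) (hD : 0 ≤ D)
    (hgD : D = 0 → g = 0)
    (hb : b ≤ a - min (g / (L * D)) 1 * g + L / 2 * min (g / (L * D)) 1 ^ 2 * D) :
    b ≤ a - g / 2 ∨ g ^ 2 ≤ 2 * L * D * (a - b) := by
  rcases hD.eq_or_lt with hD0 | hDpos
  · right
    simp [hgD hD0.symm, ← hD0]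
  · have hLD : 0 < L * D := mul_pos hL hDpos
    rcases le_total (g / (L * D)) 1 with h | h
    · right
      rw [min_eq_left h] at hb
      have key : a - g / (L * D) * g + L / 2 * (g / (L * D)) ^ 2 * D
          = a - g ^ 2 / (2 * (L * D)) := by
        field_simp
        ring
      rw [key] at hb
      have hdiv : g ^ 2 / (2 * (L * D)) ≤ a - b := by linarith
      rw [div_le_iff₀ (by positivity)] at hdiv
      linarith
    · left
      rw [min_eq_right h] at hb
      rw [le_div_iff₀ hLD] at h
      linarith

theorem sq_mul_sq_le_rpow_mul_sq {h g d u q : ℝ} (hq : 2 ≤ q) (hh : 0 ≤ h) (hd : 0 ≤ d)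
    (hu : 0 ≤ u) (hhg : h ≤ g) (hhd : h * d ^ q ≤ u * g) :
    h ^ 2 * d ^ 2 ≤ u ^ (2 / q) * g ^ 2 := by
  have hq0 : 0 < q := by linarith
  rcases hh.eq_or_lt with rfl | hpos
  · have := Real.rpow_nonneg hu (2 / q)
    simpa using mul_nonneg this (sq_nonneg g)
  · obtain ⟨r, rfl⟩ : ∃ r, g = r * h := ⟨g / h, by field_simp⟩
    have hr : 1 ≤ r := by
      by_contra! hr
      nlinarith
    have hdq : d ^ q ≤ u * r := by
      refine le_of_mul_le_mul_left ?_ hpos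
      linarith
    have hd2 : d ^ 2 = (d ^ q) ^ (2 / q) := by
      rw [← Real.rpow_mul hd, mul_div_cancel₀ _ hq0.ne', Real.rpow_two]
    have hdr : d ^ 2 ≤ u ^ (2 / q) * r ^ 2 := by
      calc d ^ 2 = (d ^ q) ^ (2 / q) := hd2
        _ ≤ (u * r) ^ (2 / q) :=
          Real.rpow_le_rpow (Real.rpow_nonneg hd q) hdq (by positivity)
        _ = u ^ (2 / q) * r ^ (2 / q) := Real.mul_rpow hu (by linarith)
        _ ≤ u ^ (2 / q) * r ^ 2 := by
          gcongr
          rw [← Real.rpow_two]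
          refine Real.rpow_le_rpow_of_exponent_le hr ?_
          rw [div_le_iff₀ hq0]
          linarith
    calc h ^ 2 * d ^ 2 ≤ h ^ 2 * (u ^ (2 / q) * r ^ 2) := by gcongr
      _ = u ^ (2 / q) * (r * h) ^ 2 := by ring

/-- A nonnegative null sequence whose decrements dominate `(h t) ^ 2` by arbitrarily large factors
is `o(1 / t)`. -/
theorem tendsto_add_two_mul_of_sq_le {h : ℕ → ℝ} (hnonneg : ∀ t, 0 ≤ h t)
    (hlim : Tendsto h atTop (nhds 0))
    (hdec : ∀ ε > 0, ∀ᶠ t in atTop, h t ^ 2 ≤ ε * (h t - h (t + 1))) :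
    Tendsto (fun t : ℕ => ((t : ℝ) + 2) * h t) atTop (nhds 0) := by
  rw [Metric.tendsto_atTop']
  intro ε hε
  obtain ⟨N, hN⟩ := eventually_atTop.1 (hdec (ε / 2) (by linarith))
  have hrate : ∀ k : ℕ, (k : ℝ) * h (N + k) ≤ ε / 2 := by
    intro k
    induction k with
    | zero => simpa using (half_pos hε).le
    | succ k ih =>
      have hstep := hN (N + k) (by omega)
      have hk : (0 : ℝ) ≤ k := k.cast_nonneg
      have h1 := hnonneg (N + k)
      have h2 := hnonneg (N + k + 1)
      rw [← add_assoc]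
      push_cast
      generalize h (N + k) = y at *
      generalize h (N + k + 1) = z at *
      by_contra! hcon
      have hzy : z ≤ y := by nlinarith [sq_nonneg y]
      have hy : ε / 2 < (k + 1) * y := hcon.trans_le (by gcongr)
      have hmul : (k + 1) * y ^ 2 ≤ ε / 2 * ((k + 1) * y - (k + 1) * z) := by
        nlinarith
      have hypos : 0 < y := by
        by_contra! hy0
        nlinarith
      nlinarith
  have hsmall : Tendsto (fun t => ((N : ℝ) + 2) * h t) atTop (nhds 0) := by
    simpa using hlim.const_mul ((N : ℝ) + 2)
  obtain ⟨K, hK⟩ := eventually_atTop.1 (hsmall.eventually (gt_mem_nhds (half_pos hε)))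
  refine ⟨max N K, fun t ht => ?_⟩
  obtain ⟨k, rfl⟩ := Nat.exists_eq_add_of_le (le_of_lt (lt_of_le_of_lt (le_max_left N K) ht))
  have h1 := hrate k
  have h2 := hK (N + k) (le_of_lt (lt_of_le_of_lt (le_max_right N K) ht))
  have h3 := hnonneg (N + k)
  rw [Real.dist_eq, sub_zero, abs_of_nonneg (by positivity)]
  push_cast
  linarith

/-- **LDS + short steps or exact line search, conditional form.**
Under local dual sharpness around a nonempty set `M ⊆ C`, if the Frank–Wolfe
iterates (short-step rule or exact line search) admit points `p_t ∈ M` with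
`f(p_t) = f(x*)`, `∇f(p_t) = 0`, and `‖x_t - p_t‖ → 0`, then
`(t+2)(f(x_t) - f(x*)) → 0`. -/
theorem lds_short_step_line_search_conditional
    {d : ℕ} {C : Set (EuclideanSpace ℝ (Fin d))}
    (hCne : C.Nonempty) (hCcomp : IsCompact C) (hCconv : Convex ℝ C)
    {f : EuclideanSpace ℝ (Fin d) → ℝ}
    {f' : EuclideanSpace ℝ (Fin d) → EuclideanSpace ℝ (Fin d)}
    (hfconv : ConvexOn ℝ Set.univ f)
    (hgrad : ∀ y, HasGradientAt f (f' y) y)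
    {L : ℝ} (hL : 0 < L)
    (hsmooth : ∀ x ∈ C, ∀ y ∈ C,
      f y ≤ f x + ⟪f' x, y - x⟫ + L / 2 * ‖y - x‖ ^ 2)
    {M : Set (EuclideanSpace ℝ (Fin d))} (hMne : M.Nonempty) (hMC : M ⊆ C)
    {lmo : EuclideanSpace ℝ (Fin d) → EuclideanSpace ℝ (Fin d)}
    (hlmo : ∀ g, lmo g ∈ C ∧ ∀ y ∈ C, ⟪g, lmo g⟫ ≤ ⟪g, y⟫)
    {A q : ℝ} (hA : 0 < A) (hq : 2 ≤ q)
    (hLDS : ∃ ρ > (0 : ℝ), ∀ x ∈ C, Metric.infDist x M < ρ →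
      ∀ g : EuclideanSpace ℝ (Fin d),
        A * ‖g‖ * ‖x - lmo g‖ ^ q ≤ ⟪g, x - lmo g⟫)
    {x s : ℕ → EuclideanSpace ℝ (Fin d)} {γ : ℕ → ℝ}
    (hx0 : x 0 ∈ C)
    (hs : ∀ t, s t = lmo (f' (x t)))
    (hupd : ∀ t, x (t + 1) = x t + γ t • (s t - x t))
    (hrule :
      (∀ t, γ t =
          min (⟪f' (x t), x t - s t⟫ / (L * ‖x t - s t‖ ^ 2)) 1)
      ∨ (∀ t, γ t ∈ Set.Icc (0 : ℝ) 1 ∧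
          ∀ γ' ∈ Set.Icc (0 : ℝ) 1,
            f (x t + γ t • (s t - x t)) ≤ f (x t + γ' • (s t - x t))))
    {xstar : EuclideanSpace ℝ (Fin d)} (hxstar : xstar ∈ C)
    {p : ℕ → EuclideanSpace ℝ (Fin d)}
    (hpM : ∀ t, p t ∈ M)
    (hpf : ∀ t, f (p t) = f xstar)
    (hpgrad : ∀ t, f' (p t) = 0)
    (hδ : Tendsto (fun t => ‖x t - p t‖) atTop (nhds 0)) :
    Tendsto (fun t : ℕ => ((t : ℝ) + 2) * (f (x t) - f xstar)) atTop (nhds 0) := by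
  set h : ℕ → ℝ := fun t => f (x t) - f xstar with hh
  set g : ℕ → ℝ := fun t => ⟪f' (x t), x t - s t⟫ with hgdef
  set D : ℕ → ℝ := fun t => ‖x t - s t‖ with hDdef
  have hpC : ∀ t, p t ∈ C := fun t => hMC (hpM t)
  have hsC : ∀ t, s t ∈ C := fun t => hs t ▸ (hlmo _).1
  have hgap : ∀ t, ∀ y ∈ C, ⟪f' (x t), x t - y⟫ ≤ g t := by
    intro t y hy
    have := (hlmo (f' (x t))).2 y hy
    simp only [hgdef, hs, inner_sub_right]
    linarith
  have hγmem : ∀ t, x t ∈ C → γ t ∈ Set.Icc (0 : ℝ) 1 := by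
    intro t hxt
    rcases hrule with hr | hr
    · rw [hr t]
      have hg0 : 0 ≤ g t := by simpa using hgap t (x t) hxt
      exact ⟨le_min (div_nonneg hg0 (by positivity)) zero_le_one, min_le_right _ _⟩
    · exact (hr t).1
  have hxC : ∀ t, x t ∈ C := by
    intro t
    induction t with
    | zero => exact hx0
    | succ t ih =>
      rw [hupd]
      exact hCconv.add_smul_sub_mem ih (hsC t) (hγmem t ih)
  have hg0 : ∀ t, 0 ≤ g t := fun t => by simpa using hgap t (x t) (hxC t)
  have hhnonneg : ∀ t, 0 ≤ h t := by
    intro t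
    have := hfconv.add_inner_le_of_hasGradientAt (hgrad (p t)) (x t)
    rw [hpgrad, hpf, inner_zero_left] at this
    simp only [hh]
    linarith
  have hhinner : ∀ t, h t ≤ ⟪f' (x t), x t - p t⟫ := by
    intro t
    have := hfconv.add_inner_le_of_hasGradientAt (hgrad (x t)) (p t)
    rw [hpf, ← neg_sub (x t) (p t), inner_neg_right] at this
    simp only [hh]
    linarith
  have hhg : ∀ t, h t ≤ g t := fun t => (hhinner t).trans (hgap t _ (hpC t))
  have hhlim : Tendsto h atTop (nhds 0) := by
    refine squeeze_zero (g := fun t => L / 2 * ‖x t - p t‖ ^ 2) hhnonneg (fun t => ?_) ?_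
    · have := hsmooth (p t) (hpC t) (x t) (hxC t)
      rw [hpgrad, hpf, inner_zero_left] at this
      simp only [hh]
      linarith
    · simpa using (hδ.pow 2).const_mul (L / 2)
  have hprogress : ∀ t, h (t + 1) ≤ h t - g t / 2 ∨
      g t ^ 2 ≤ 2 * L * D t ^ 2 * (h t - h (t + 1)) := by
    intro t
    refine quadratic_model_decrease hL (sq_nonneg _) (fun hD0 => ?_) ?_
    · have : x t - s t = 0 := by simpa [hDdef] using hD0
      simp [hgdef, this]
    · set r : ℝ := min (g t / (L * D t ^ 2)) 1 with hr
      have hrmem : r ∈ Set.Icc (0 : ℝ) 1 :=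
        ⟨le_min (div_nonneg (hg0 t) (by positivity)) zero_le_one, min_le_right _ _⟩
      have hle : f (x (t + 1)) ≤ f (x t + r • (s t - x t)) := by
        rw [hupd]
        rcases hrule with hrule | hrule
        · rw [hrule t]
        · exact (hrule t).2 r hrmem
      have hsm := hsmooth (x t) (hxC t) _ (hCconv.add_smul_sub_mem (hxC t) (hsC t) hrmem)
      rw [add_sub_cancel_left, ← neg_sub (x t) (s t), inner_smul_right, inner_neg_right,
        norm_smul, norm_neg, mul_pow, Real.norm_eq_abs, sq_abs, neg_sub] at hsm
      simp only [hh]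
      change _ ≤ f (x t) + r * -(g t) + L / 2 * (r ^ 2 * D t ^ 2) at hsm
      linarith
  obtain ⟨ρ, hρ, hLDS⟩ := hLDS
  refine tendsto_add_two_mul_of_sq_le hhnonneg hhlim fun ε hε => ?_
  have hu : Tendsto (fun t => 2 * L * (‖x t - p t‖ / A) ^ (2 / q)) atTop (nhds 0) := by
    have hq0 : 0 < 2 / q := by positivity
    have := ((hδ.div_const A).rpow_const (Or.inr hq0.le)).const_mul (2 * L)
    simpa [Real.zero_rpow hq0.ne'] using this
  filter_upwards [hδ.eventually (gt_mem_nhds hρ), hu.eventually (gt_mem_nhds hε),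
    hhlim.eventually (gt_mem_nhds (half_pos hε))] with t hρt hut hht
  change h t ^ 2 ≤ ε * (h t - h (t + 1))
  have hdist : Metric.infDist (x t) M < ρ :=
    (Metric.infDist_le_dist_of_mem (hpM t)).trans_lt (by rwa [dist_eq_norm])
  have hsharp := hLDS (x t) (hxC t) hdist (f' (x t))
  rw [← hs t] at hsharp
  change A * ‖f' (x t)‖ * D t ^ q ≤ g t at hsharp
  have hDq : 0 ≤ D t ^ q := Real.rpow_nonneg (norm_nonneg _) q
  have hhD : h t * D t ^ q ≤ ‖x t - p t‖ / A * g t := by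
    have hcs : h t ≤ ‖f' (x t)‖ * ‖x t - p t‖ :=
      (hhinner t).trans (real_inner_le_norm _ _)
    calc h t * D t ^ q ≤ ‖f' (x t)‖ * ‖x t - p t‖ * D t ^ q := by gcongr
      _ = ‖x t - p t‖ / A * (A * ‖f' (x t)‖ * D t ^ q) := by field_simp
      _ ≤ ‖x t - p t‖ / A * g t := by gcongr
  have hsq := sq_mul_sq_le_rpow_mul_sq hq (hhnonneg t) (norm_nonneg _)
    (div_nonneg (norm_nonneg (x t - p t)) hA.le) (hhg t) hhD
  change h t ^ 2 * D t ^ 2 ≤ _ at hsq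
  have hh0 := hhnonneg t
  rcases hprogress t with hp | hp
  · have := hhg t
    nlinarith
  · rcases (norm_nonneg (x t - s t)).eq_or_lt with hD0 | hDpos
    · have hxs : x t = s t := sub_eq_zero.1 (norm_eq_zero.1 hD0.symm)
      have hgt : g t = 0 := by simp [hgdef, hxs]
      have hht0 : h t = 0 := le_antisymm (hgt ▸ hhg t) hh0
      have hstay : h (t + 1) = h t := by simp [hh, hupd, ← hxs]
      rw [hstay, hht0]
      simp
    · have hD2 : 0 < D t ^ 2 := pow_pos hDpos 2
      have hdiff : 0 ≤ h t - h (t + 1) := by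
        by_contra! hneg
        nlinarith [sq_nonneg (g t), mul_pos hL hD2]
      refine le_of_mul_le_mul_right ?_ hD2
      calc h t ^ 2 * D t ^ 2 ≤ (‖x t - p t‖ / A) ^ (2 / q) * g t ^ 2 := hsq
        _ ≤ (‖x t - p t‖ / A) ^ (2 / q) * (2 * L * D t ^ 2 * (h t - h (t + 1))) := by gcongr
        _ = 2 * L * (‖x t - p t‖ / A) ^ (2 / q) * (D t ^ 2 * (h t - h (t + 1))) := by ring
        _ ≤ ε * (D t ^ 2 * (h t - h (t + 1))) := by gcongr
        _ = ε * (h t - h (t + 1)) * D t ^ 2 := by ring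
end

section
/- (LDS + short steps or line search with a zero-gradient minimizer) Let 𝓜 = argmin_{x∈C} f(x). Assume the Frank–Wolfe iterates are generated either by the short-step rule or by exact line search, and suppose C together with its LMO satisfies local dual sharpness around 𝓜 with some constants (A, q). If 𝓜 contains a point x* with ∇f(x*) = 0, then f(x_t) − f* = o(1/t), i.e., t·(f(x_t) − f*) → 0. -/
open scoped RealInnerProductSpace
open Filter

/-- First-order characterization of convexity on a real inner product space. -/
theorem ConvexOn.inner_gradient_le_sub {E : Type*} [NormedAddCommGroup E] [InnerProductSpace ℝ E]
    [CompleteSpace E] {f : E → ℝ} (hf : ConvexOn ℝ Set.univ f) {g x : E}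
    (hg : HasGradientAt f g x) (y : E) : ⟪g, y - x⟫ ≤ f y - f x := by
  have hconv : ConvexOn ℝ Set.univ (fun t : ℝ => f (AffineMap.lineMap x y t)) := by
    simpa [Function.comp_def] using hf.comp_affineMap (AffineMap.lineMap x y)
  have hderiv : HasDerivAt (fun t : ℝ => f (AffineMap.lineMap x y t)) ⟪g, y - x⟫ 0 := by
    have hg' : HasFDerivAt f (InnerProductSpace.toDual ℝ E g) (AffineMap.lineMap x y (0 : ℝ)) := by
      simpa using hg.hasFDerivAt
    simpa [Function.comp_def] using hg'.comp_hasDerivAt (0 : ℝ) AffineMap.hasDerivAt_lineMap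
  have hslope := hconv.le_slope_of_hasDerivAt (Set.mem_univ 0) (Set.mem_univ 1) one_pos hderiv
  simpa [slope_def_field] using hslope

/-- A nonnegative sequence with eventual decrease at least `c * h t ^ 2` is `O(1 / (c * t))`. -/
theorem mul_le_two_of_succ_le_sub_sq {h : ℕ → ℝ} (hnn : ∀ t, 0 ≤ h t) {c : ℝ} (hc : 0 < c)
    {N : ℕ} (hdec : ∀ t ≥ N, h (t + 1) ≤ h t - c * h t ^ 2) {t : ℕ} (ht : 2 * N ≤ t) :
    c * (t * h t) ≤ 2 := by
  have key : ∀ k : ℕ, k * (c * h (N + k)) ≤ 1 := by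
    intro k
    induction k with
    | zero => simp
    | succ k ih =>
      have hd := hdec (N + k) (by omega)
      have hn := hnn (N + (k + 1))
      rw [← add_assoc] at hn ⊢
      have hu0 : 0 ≤ c * h (N + k) := mul_nonneg hc.le (hnn _)
      have hd' : c * h (N + k + 1) ≤ c * h (N + k) - (c * h (N + k)) ^ 2 := by
        nlinarith [mul_le_mul_of_nonneg_left hd hc.le]
      have hn' : 0 ≤ c * h (N + k + 1) := mul_nonneg hc.le hn
      generalize c * h (N + k) = u at *
      generalize c * h (N + k + 1) = v at *
      have hu1 : u ≤ 1 := by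
        by_contra! hgt
        nlinarith
      push_cast
      nlinarith [mul_nonneg (sub_nonneg.2 ih) (sub_nonneg.2 hu1), sq_nonneg u,
        mul_le_mul_of_nonneg_left hd' (by positivity : (0 : ℝ) ≤ (k : ℝ) + 1)]
  obtain ⟨k, rfl⟩ := Nat.exists_eq_add_of_le (show N ≤ t by omega)
  have hNk : (N : ℝ) ≤ k := by exact_mod_cast (show N ≤ k by omega)
  have hmul := mul_le_mul_of_nonneg_right hNk (mul_nonneg hc.le (hnn (N + k)))
  push_cast
  linarith [key k]

theorem tendsto_nat_mul_zero_of_succ_le_sub_sq {h : ℕ → ℝ} (hnn : ∀ t, 0 ≤ h t)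
    (hdec : ∀ c > 0, ∀ᶠ t in atTop, h (t + 1) ≤ h t - c * h t ^ 2) :
    Tendsto (fun t : ℕ => (t : ℝ) * h t) atTop (nhds 0) := by
  rw [Metric.tendsto_atTop]
  intro ε hε
  obtain ⟨N, hN⟩ := eventually_atTop.1 (hdec (3 / ε) (by positivity))
  refine ⟨2 * N, fun t ht => ?_⟩
  have hbound := mul_le_two_of_succ_le_sub_sq hnn (by positivity) hN ht
  rw [Real.dist_eq, sub_zero, abs_of_nonneg (mul_nonneg (Nat.cast_nonneg t) (hnn t))]
  rw [div_mul_eq_mul_div, div_le_iff₀ hε] at hbound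
  linarith

theorem tendsto_zero_of_succ_le_sub_sq {h : ℕ → ℝ} (hnn : ∀ t, 0 ≤ h t) {c : ℝ} (hc : 0 < c)
    (hdec : ∀ t, h (t + 1) ≤ h t - c * h t ^ 2) : Tendsto h atTop (nhds 0) := by
  refine tendsto_of_tendsto_of_tendsto_of_le_of_le' tendsto_const_nhds
    (tendsto_const_div_atTop_nhds_zero_nat (2 / c)) (.of_forall hnn) ?_
  filter_upwards [eventually_gt_atTop 0] with t ht
  have ht' : (0 : ℝ) < t := Nat.cast_pos.2 ht
  have hbound := mul_le_two_of_succ_le_sub_sq hnn hc (N := 0) (fun t _ => hdec t) (Nat.zero_le t)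
  rw [le_div_iff₀ ht', le_div_iff₀ hc]
  linarith

/-- A minimizing sequence in a compact set approaches the set of minimizers. -/
theorem IsCompact.eventually_infDist_argmin_lt {X : Type*} [PseudoMetricSpace X] {C : Set X}
    (hC : IsCompact C) {f : X → ℝ} (hf : ContinuousOn f C) {m : ℝ} (hm : ∀ y ∈ C, m ≤ f y)
    {x : ℕ → X} (hx : ∀ t, x t ∈ C) (hlim : Tendsto (fun t => f (x t)) atTop (nhds m))
    {δ : ℝ} (hδ : 0 < δ) :
    ∀ᶠ t in atTop, Metric.infDist (x t) {y | y ∈ C ∧ f y = m} < δ := by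
  set M := {y | y ∈ C ∧ f y = m}
  have hK : IsCompact (C ∩ {y | δ ≤ Metric.infDist y M}) :=
    hC.inter_right (isClosed_le continuous_const (Metric.continuous_infDist_pt M))
  rcases (C ∩ {y | δ ≤ Metric.infDist y M}).eq_empty_or_nonempty with hempty | hne
  · refine .of_forall fun t => ?_
    by_contra! hle
    exact Set.eq_empty_iff_forall_notMem.1 hempty (x t) ⟨hx t, hle⟩
  · obtain ⟨z, ⟨hzC, hzδ⟩, hzmin⟩ := hK.exists_isMinOn hne (hf.mono Set.inter_subset_left)
    have hlt : m < f z := by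
      refine lt_of_le_of_ne (hm z hzC) fun heq => ?_
      have hz0 : Metric.infDist z M = 0 := Metric.infDist_zero_of_mem ⟨hzC, heq.symm⟩
      have hzδ' : δ ≤ Metric.infDist z M := hzδ
      linarith
    filter_upwards [hlim.eventually_lt_const hlt] with t ht
    by_contra! hle
    exact (isMinOn_iff.1 hzmin (x t) ⟨hx t, hle⟩).not_gt ht

theorem min_div_one_mem_Icc {g a : ℝ} (hg : 0 ≤ g) (ha : 0 ≤ a) :
    min (g / a) 1 ∈ Set.Icc (0 : ℝ) 1 :=
  ⟨le_min (div_nonneg hg ha) zero_le_one, min_le_right _ _⟩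

/-- The short step minimizes the quadratic upper model over `[0, 1]`. -/
theorem short_step_model_le {g a : ℝ} (ha : 0 ≤ a) (hga : a = 0 → g = 0) {γ : ℝ}
    (hγ : γ ∈ Set.Icc (0 : ℝ) 1) :
    -(min (g / a) 1 * g) + a / 2 * min (g / a) 1 ^ 2 ≤ -(γ * g) + a / 2 * γ ^ 2 := by
  obtain ⟨hγ0, hγ1⟩ := hγ
  rcases ha.eq_or_lt with ha0 | hapos
  · simp [← ha0, hga ha0.symm]
  · rcases le_total g a with hle | hle
    · rw [min_eq_left ((div_le_one hapos).2 hle)]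
      obtain ⟨u, rfl⟩ : ∃ u, g = a * u := ⟨g / a, by field_simp⟩
      rw [mul_div_cancel_left₀ _ hapos.ne']
      nlinarith [mul_nonneg hapos.le (sq_nonneg (u - γ))]
    · rw [min_eq_right ((one_le_div hapos).2 hle)]
      nlinarith [mul_nonneg (sub_nonneg.2 hle) (sub_nonneg.2 hγ1),
        mul_nonneg hapos.le (sq_nonneg (1 - γ))]

/-- Decrease of the primal gap from a model bound with step size `c * h`. -/
theorem succ_le_sub_sq_of_model_bound {h h' g a c : ℝ} (hh : 0 ≤ h) (hc : 0 < c)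
    (hmodel : ∀ γ ∈ Set.Icc (0 : ℝ) 1, h' ≤ h - γ * g + a / 2 * γ ^ 2)
    (hhg : h ≤ g) (hch : c * h ≤ 1) (hag : a * (c * h) ≤ g) :
    h' ≤ h - c / 2 * h ^ 2 := by
  have hch0 : 0 ≤ c * h := mul_nonneg hc.le hh
  nlinarith [hmodel (c * h) ⟨hch0, hch⟩, mul_le_mul_of_nonneg_left hag hch0,
    mul_le_mul_of_nonneg_left hhg hch0]

/-- **LDS + short steps or line search with a zero-gradient minimizer.**
If local dual sharpness holds around the minimizer set `𝓜` and `𝓜` contains a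
point `x*` with `∇f(x*) = 0`, then for short steps or exact line search
`f(x_t) - f* = o(1/t)`. -/
theorem lds_short_step_line_search_zero_gradient_minimizer
    {d : ℕ} {C : Set (EuclideanSpace ℝ (Fin d))}
    (hCne : C.Nonempty) (hCcomp : IsCompact C) (hCconv : Convex ℝ C)
    {f : EuclideanSpace ℝ (Fin d) → ℝ}
    {f' : EuclideanSpace ℝ (Fin d) → EuclideanSpace ℝ (Fin d)}
    (hfconv : ConvexOn ℝ Set.univ f)
    (hgrad : ∀ y, HasGradientAt f (f' y) y)
    {L : ℝ} (hL : 0 < L)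
    (hsmooth : ∀ x ∈ C, ∀ y ∈ C,
      f y ≤ f x + ⟪f' x, y - x⟫ + L / 2 * ‖y - x‖ ^ 2)
    {fstar : ℝ} (hfstar : IsLeast (f '' C) fstar)
    {lmo : EuclideanSpace ℝ (Fin d) → EuclideanSpace ℝ (Fin d)}
    (hlmo : ∀ g, lmo g ∈ C ∧ ∀ y ∈ C, ⟪g, lmo g⟫ ≤ ⟪g, y⟫)
    {A q : ℝ} (hA : 0 < A) (hq : 2 ≤ q)
    (hLDS : ∃ ρ > (0 : ℝ), ∀ x ∈ C,
      Metric.infDist x {y | y ∈ C ∧ f y = fstar} < ρ →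
      ∀ g : EuclideanSpace ℝ (Fin d),
        A * ‖g‖ * ‖x - lmo g‖ ^ q ≤ ⟪g, x - lmo g⟫)
    {x s : ℕ → EuclideanSpace ℝ (Fin d)} {γ : ℕ → ℝ}
    (hx0 : x 0 ∈ C)
    (hs : ∀ t, s t = lmo (f' (x t)))
    (hupd : ∀ t, x (t + 1) = x t + γ t • (s t - x t))
    (hrule :
      (∀ t, γ t =
          min (⟪f' (x t), x t - s t⟫ / (L * ‖x t - s t‖ ^ 2)) 1)
      ∨ (∀ t, γ t ∈ Set.Icc (0 : ℝ) 1 ∧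
          ∀ γ' ∈ Set.Icc (0 : ℝ) 1,
            f (x t + γ t • (s t - x t)) ≤ f (x t + γ' • (s t - x t))))
    {xstar : EuclideanSpace ℝ (Fin d)}
    (hxstarM : xstar ∈ C ∧ f xstar = fstar)
    (hxstargrad : f' xstar = 0) :
    Tendsto (fun t : ℕ => (t : ℝ) * (f (x t) - fstar)) atTop (nhds 0) := by
  obtain ⟨hxsC, hfxs⟩ := hxstarM
  obtain ⟨ρ, hρ, hLDS⟩ := hLDS
  have hMne : {y | y ∈ C ∧ f y = fstar}.Nonempty := ⟨xstar, hxsC, hfxs⟩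
  have hmin : ∀ y ∈ C, fstar ≤ f y := fun y hy => hfstar.2 ⟨y, hy, rfl⟩
  have hsC : ∀ t, s t ∈ C := fun t => hs t ▸ (hlmo _).1
  have hgap : ∀ t, ∀ y ∈ C, f (x t) - f y ≤ ⟪f' (x t), x t - s t⟫ := fun t y hy => by
    have hsub := hfconv.inner_gradient_le_sub (hgrad (x t)) y
    have hopt := (hlmo (f' (x t))).2 y hy
    rw [← hs t] at hopt
    rw [inner_sub_right] at hsub ⊢
    linarith
  have hmove : ∀ t, x t ∈ C → ∀ γ' ∈ Set.Icc (0 : ℝ) 1, x t + γ' • (s t - x t) ∈ C :=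
    fun t ht γ' hγ' => hCconv.add_smul_sub_mem ht (hsC t) hγ'
  have hgapnn : ∀ t, x t ∈ C → 0 ≤ ⟪f' (x t), x t - s t⟫ := fun t ht => by
    simpa using hgap t (x t) ht
  have hγmem : ∀ t, x t ∈ C → γ t ∈ Set.Icc (0 : ℝ) 1 := fun t ht => by
    rcases hrule with hshort | hline
    · exact hshort t ▸ min_div_one_mem_Icc (hgapnn t ht) (by positivity)
    · exact (hline t).1
  have hxC : ∀ t, x t ∈ C := fun t => by
    induction t with
    | zero => exact hx0
    | succ t ih => exact hupd t ▸ hmove t ih _ (hγmem t ih)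
  have hquad : ∀ t, ∀ γ' ∈ Set.Icc (0 : ℝ) 1, f (x t + γ' • (s t - x t)) ≤
      f (x t) - γ' * ⟪f' (x t), x t - s t⟫ + L * ‖x t - s t‖ ^ 2 / 2 * γ' ^ 2 :=
    fun t γ' hγ' => by
      have hsm := hsmooth (x t) (hxC t) _ (hmove t (hxC t) γ' hγ')
      rw [add_sub_cancel_left, inner_smul_right, norm_smul, mul_pow, Real.norm_eq_abs, sq_abs,
        norm_sub_rev, ← neg_sub (x t) (s t), inner_neg_right, neg_sub] at hsm
      linarith
  set h : ℕ → ℝ := fun t => f (x t) - fstar with hh_def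
  have hnn : ∀ t, 0 ≤ h t := fun t => sub_nonneg.2 (hmin _ (hxC t))
  have hhg : ∀ t, h t ≤ ⟪f' (x t), x t - s t⟫ := fun t => by
    simpa only [hh_def, hfxs] using hgap t xstar hxsC
  have hmodel : ∀ t, ∀ γ' ∈ Set.Icc (0 : ℝ) 1, h (t + 1) ≤
      h t - γ' * ⟪f' (x t), x t - s t⟫ + L * ‖x t - s t‖ ^ 2 / 2 * γ' ^ 2 :=
    fun t γ' hγ' => by
      simp only [hh_def, hupd t]
      rcases hrule with hshort | hline
      · have hq1 := hquad t (γ t) (hγmem t (hxC t))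
        have hq2 := short_step_model_le (g := ⟪f' (x t), x t - s t⟫)
          (a := L * ‖x t - s t‖ ^ 2) (by positivity)
          (fun h0 => by
            have hz : x t - s t = 0 := by simpa [hL.ne'] using h0
            simp [hz]) hγ'
        rw [← hshort t] at hq2
        linarith
      · linarith [(hline t).2 γ' hγ', hquad t γ' hγ']
  have hlim : Tendsto h atTop (nhds 0) := by
    obtain ⟨D, hD⟩ := hCcomp.isBounded.exists_norm_le
    have hdD : ∀ t, ‖x t - s t‖ ^ 2 ≤ (D + D) ^ 2 := fun t => by
      gcongr
      exact (norm_sub_le _ _).trans (add_le_add (hD _ (hxC t)) (hD _ (hsC t)))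
    have hanti : ∀ t, h t ≤ h 0 := fun t => by
      induction t with
      | zero => exact le_rfl
      | succ t ih => simpa using (hmodel t 0 (by simp)).trans (by simpa using ih)
    set b : ℝ := 1 + h 0 + L * (D + D) ^ 2
    have hb : 0 < b := by have := hnn 0; positivity
    have hc : 0 < 1 / b := by positivity
    refine tendsto_zero_of_succ_le_sub_sq hnn (half_pos hc) fun t =>
      succ_le_sub_sq_of_model_bound (hnn t) hc (hmodel t) (hhg t) ?_ ?_
    · rw [one_div_mul_eq_div, div_le_one hb]
      have : 0 ≤ L * (D + D) ^ 2 := by positivity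
      simp only [b]
      linarith [hanti t]
    · refine le_trans ?_ (hhg t)
      rw [one_div_mul_eq_div, mul_div_assoc', div_le_iff₀ hb, mul_comm]
      refine mul_le_mul_of_nonneg_left ?_ (hnn t)
      have := mul_le_mul_of_nonneg_left (hdD t) hL.le
      simp only [b]
      linarith [hnn 0]
  have hflim : Tendsto (fun t => f (x t)) atTop (nhds fstar) := by
    simpa [hh_def] using hlim.add_const fstar
  have hfcont : ContinuousOn f C := fun y _ => (hgrad y).continuousAt.continuousWithinAt
  have hnear : ∀ δ > 0, ∀ᶠ t in atTop,
      Metric.infDist (x t) {y | y ∈ C ∧ f y = fstar} < δ :=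
    fun δ hδ => hCcomp.eventually_infDist_argmin_lt hfcont hmin hxC hflim hδ
  refine tendsto_nat_mul_zero_of_succ_le_sub_sq hnn fun c hc => ?_
  set r : ℝ := √(1 / (L * (2 * c)))
  have hr : 0 < r := by positivity
  have hr2 : L * (2 * c) * r ^ 2 = 1 := by
    rw [Real.sq_sqrt (by positivity)]
    field_simp
  have hκ : 0 < r ^ (q - 2) := by positivity
  have hδ : 0 < A * r ^ (q - 2) / (L * (2 * c)) := by positivity
  filter_upwards [hnear ρ hρ, hnear _ hδ,
    hlim.eventually_lt_const (show 0 < 1 / (2 * c) by positivity)] with t htρ htδ hth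
  have hdec := succ_le_sub_sq_of_model_bound (c := 2 * c) (hnn t) (by positivity) (hmodel t)
    (hhg t) (by rw [lt_div_iff₀ (by positivity)] at hth; linarith) ?_
  · rwa [mul_div_cancel_left₀ c two_ne_zero] at hdec
  rcases le_total ‖x t - s t‖ r with hdr | hdr
  · refine le_trans ?_ (hhg t)
    have hsq : ‖x t - s t‖ ^ 2 ≤ r ^ 2 := by gcongr
    have hmul := mul_le_mul_of_nonneg_left hsq
      (show 0 ≤ L * (2 * c) * h t from mul_nonneg (by positivity) (hnn t))
    linear_combination hmul + h t * hr2
  · obtain ⟨y, ⟨hyC, hyf⟩, hyd⟩ := (Metric.infDist_lt_iff hMne).1 htδ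
    have hgradle : h t ≤ ‖f' (x t)‖ * (A * r ^ (q - 2) / (L * (2 * c))) := by
      have hsub := hfconv.inner_gradient_le_sub (hgrad (x t)) y
      have hcs := abs_le.1 (abs_real_inner_le_norm (f' (x t)) (y - x t))
      have hd : ‖y - x t‖ ≤ A * r ^ (q - 2) / (L * (2 * c)) := by
        rw [← dist_eq_norm, dist_comm]
        exact hyd.le
      have := mul_le_mul_of_nonneg_left hd (norm_nonneg (f' (x t)))
      simp only [hh_def, ← hyf]
      linarith [hcs.1]
    rw [mul_div_assoc', le_div_iff₀ (by positivity)] at hgradle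
    have hlds := hLDS (x t) (hxC t) htρ (f' (x t))
    rw [← hs t] at hlds
    have hd0 : 0 < ‖x t - s t‖ := hr.trans_le hdr
    have hpow : r ^ (q - 2) * ‖x t - s t‖ ^ 2 ≤ ‖x t - s t‖ ^ q := by
      calc r ^ (q - 2) * ‖x t - s t‖ ^ 2
          ≤ ‖x t - s t‖ ^ (q - 2) * ‖x t - s t‖ ^ 2 := by
            gcongr
        _ = ‖x t - s t‖ ^ q := by
            rw [← Real.rpow_natCast, ← Real.rpow_add hd0]
            norm_num
    have h1 := mul_le_mul_of_nonneg_right hgradle (sq_nonneg ‖x t - s t‖)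
    have h2 := mul_le_mul_of_nonneg_left hpow
      (show 0 ≤ A * ‖f' (x t)‖ by positivity)
    linarith
end

section
/- (A uniformly-convex patch with residual gap yields local dual sharpness) Let M ⊆ C be nonempty and K ⊆ ℝ^d be (α, q)-uniformly convex with q ≥ 2. Suppose there exist ρ, β > 0 such that whenever x ∈ C satisfies dist(x, M) < ρ, then x ∈ K, and for every g ∈ ℝ^d, if s is the atom selected by the LMO for the linear objective y ↦ ⟨g, y⟩, then at least one of the following holds: (i) s ∈ K and ⟨g, y − s⟩ ≥ 0 for all y ∈ K (s supports K in direction g); (ii) β‖g‖ ≤ ⟨g, x − s⟩. Then the LMO satisfies local dual sharpness around M with constants (min{α/2, β/max{1, diam(C)^q}}, q). -/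
open scoped RealInnerProductSpace
open Filter

/-- An atom supporting a uniformly convex set in direction `g` satisfies a sharpness inequality
against every point of the set. -/
theorem half_mul_norm_mul_rpow_le_inner_of_supports {E : Type*} [NormedAddCommGroup E]
    [InnerProductSpace ℝ E] {K : Set E} {α q : ℝ}
    (hUC : ∀ x ∈ K, ∀ y ∈ K, ∀ lam ∈ Set.Icc (0 : ℝ) 1, ∀ z : E, ‖z‖ = 1 →
      lam • x + (1 - lam) • y + (lam * (1 - lam) * α * ‖x - y‖ ^ q) • z ∈ K)
    {g s x : E} (hs : s ∈ K) (hsupp : ∀ y ∈ K, 0 ≤ ⟪g, y - s⟫) (hx : x ∈ K) :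
    α / 2 * ‖g‖ * ‖x - s‖ ^ q ≤ ⟪g, x - s⟫ := by
  rcases eq_or_ne g 0 with rfl | hg
  · simp
  have hg' : ‖g‖ ≠ 0 := norm_ne_zero_iff.mpr hg
  have hz : ‖-(‖g‖⁻¹ • g)‖ = 1 := by
    rw [norm_neg, norm_smul, norm_inv, norm_norm, inv_mul_cancel₀ hg']
  have hgap := hsupp _ (hUC x hx s hs (1 / 2) (by norm_num) _ hz)
  have hdir : ⟪g, -(‖g‖⁻¹ • g)⟫ = -‖g‖ := by
    rw [inner_neg_right, real_inner_smul_right, real_inner_self_eq_norm_sq]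
    field_simp
  rw [inner_sub_right, inner_add_right, inner_add_right, real_inner_smul_right,
    real_inner_smul_right, real_inner_smul_right, hdir] at hgap
  rw [inner_sub_right]
  linarith

/-- **A uniformly-convex patch with residual gap yields local dual sharpness.**
If near `M` the feasible set lies in an `(α,q)`-uniformly convex set `K` and every
selected atom either supports `K` in the LMO direction or carries a residual gap
`β‖g‖ ≤ ⟪g, x - s⟫`, then local dual sharpness holds around `M` with constants
`(min{α/2, β/max{1, diam(C)^q}}, q)`. -/
theorem patch_residual_gap_implies_lds
    {d : ℕ} {C : Set (EuclideanSpace ℝ (Fin d))}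
    (hCne : C.Nonempty) (hCcomp : IsCompact C) (hCconv : Convex ℝ C)
    {M : Set (EuclideanSpace ℝ (Fin d))} (hMne : M.Nonempty) (hMC : M ⊆ C)
    {K : Set (EuclideanSpace ℝ (Fin d))}
    {α q : ℝ} (hα : 0 < α) (hq : 2 ≤ q)
    (hUC : ∀ x ∈ K, ∀ y ∈ K, ∀ lam ∈ Set.Icc (0 : ℝ) 1,
      ∀ z : EuclideanSpace ℝ (Fin d), ‖z‖ = 1 →
        lam • x + (1 - lam) • y + (lam * (1 - lam) * α * ‖x - y‖ ^ q) • z ∈ K)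
    {lmo : EuclideanSpace ℝ (Fin d) → EuclideanSpace ℝ (Fin d)}
    (hlmo : ∀ g, lmo g ∈ C ∧ ∀ y ∈ C, ⟪g, lmo g⟫ ≤ ⟪g, y⟫)
    {ρ β : ℝ} (hρ : 0 < ρ) (hβ : 0 < β)
    (hpatch : ∀ x ∈ C, Metric.infDist x M < ρ →
      x ∈ K ∧ ∀ g : EuclideanSpace ℝ (Fin d),
        (lmo g ∈ K ∧ ∀ y ∈ K, 0 ≤ ⟪g, y - lmo g⟫) ∨
        β * ‖g‖ ≤ ⟪g, x - lmo g⟫) :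
    ∃ ρ' > (0 : ℝ), ∀ x ∈ C, Metric.infDist x M < ρ' →
      ∀ g : EuclideanSpace ℝ (Fin d),
        min (α / 2) (β / max 1 (Metric.diam C ^ q)) * ‖g‖ * ‖x - lmo g‖ ^ q ≤
          ⟪g, x - lmo g⟫ := by
  refine ⟨ρ, hρ, fun x hx hxM g => ?_⟩
  obtain ⟨hxK, hg⟩ := hpatch x hx hxM
  have hpow : 0 ≤ ‖x - lmo g‖ ^ q := by positivity
  rcases hg g with ⟨hs, hsupp⟩ | hgap
  · refine le_trans ?_ (half_mul_norm_mul_rpow_le_inner_of_supports hUC hs hsupp hxK)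
    gcongr
    exact min_le_left _ _
  · have hmax : 0 < max 1 (Metric.diam C ^ q) := lt_max_of_lt_left one_pos
    have hdist : ‖x - lmo g‖ ≤ Metric.diam C := by
      rw [← dist_eq_norm]
      exact Metric.dist_le_diam_of_mem hCcomp.isBounded hx (hlmo g).1
    have hle : ‖x - lmo g‖ ^ q ≤ max 1 (Metric.diam C ^ q) :=
      (Real.rpow_le_rpow (norm_nonneg _) hdist (by linarith)).trans (le_max_right _ _)
    calc min (α / 2) (β / max 1 (Metric.diam C ^ q)) * ‖g‖ * ‖x - lmo g‖ ^ q
        ≤ β / max 1 (Metric.diam C ^ q) * ‖g‖ * max 1 (Metric.diam C ^ q) := by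
          gcongr
          exact min_le_right _ _
      _ = β * ‖g‖ := by field_simp
      _ ≤ ⟪g, x - lmo g⟫ := hgap
end

section
/- (The stadium satisfies local dual sharpness without being uniformly convex) Let a > 0, let C_stad(a) = ([−a, a] × {0}) + B_2(0, 1) ⊆ ℝ² be the stadium (Minkowski sum of a horizontal segment and the closed Euclidean unit disk), and let K_a⁺ = (a, 0) + B_2(0, 1) be its right cap. Let M be any nonempty compact subset of the open right semicircle Γ_a⁺ = {(a + cos θ, sin θ) : −π/2 < θ < π/2}. Then C_stad(a), with any fixed deterministic LMO atom-selection rule, satisfies local dual sharpness around M with power q = 2, i.e., there exist A > 0 and ρ > 0 such that for every x ∈ C_stad(a) with dist(x, M) < ρ, every g ∈ ℝ², and the selected atom s ∈ argmin_{y∈C_stad(a)} ⟨g, y⟩, one has A‖g‖‖x − s‖² ≤ ⟨g, x − s⟩. -/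
open scoped RealInnerProductSpace Pointwise
open Filter

/-- Membership in the stadium in coordinates. -/
lemma mem_stadium_iff {a : ℝ} (y : EuclideanSpace ℝ (Fin 2)) :
    y ∈ {y : EuclideanSpace ℝ (Fin 2) | y 0 ∈ Set.Icc (-a) a ∧ y 1 = 0} +
        Metric.closedBall (0 : EuclideanSpace ℝ (Fin 2)) 1 ↔
      ∃ c ∈ Set.Icc (-a) a, (y 0 - c) ^ 2 + y 1 ^ 2 ≤ 1 := by
  have hball (b : EuclideanSpace ℝ (Fin 2)) : ‖b‖ ≤ 1 ↔ b 0 ^ 2 + b 1 ^ 2 ≤ 1 := by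
    rw [← sq_le_one_iff₀ (norm_nonneg b), EuclideanSpace.real_norm_sq_eq, Fin.sum_univ_two]
  simp only [Set.mem_add, mem_closedBall_zero_iff, hball, Set.mem_ofPred_eq]
  constructor
  · rintro ⟨c, ⟨hc, hc1⟩, b, hb, rfl⟩
    exact ⟨c 0, hc, by simpa [hc1] using hb⟩
  · rintro ⟨c, hc, h⟩
    refine ⟨!₂[c, 0], by simpa using hc, y - !₂[c, 0], by simpa using h, by simp⟩

/-- If `v` is a unit vector and `s` maximizes `v` over the stadium at least as well as the point
`(a, 0) + v`, then every point `x` of the right cap at horizontal distance at least `t` from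
the centre of the cap satisfies a quadratic sharpness estimate. -/
lemma stadium_sharpness_of_unit {a t c v₀ v₁ s₀ s₁ x₀ x₁ : ℝ} (ht : 0 < t)
    (hv : v₀ ^ 2 + v₁ ^ 2 = 1) (hc : c ∈ Set.Icc (-a) a)
    (hs : (s₀ - c) ^ 2 + s₁ ^ 2 ≤ 1) (hmax : v₀ * (a + v₀) + v₁ * v₁ ≤ v₀ * s₀ + v₁ * s₁)
    (hxt : t ≤ x₀ - a) (hx : (x₀ - a) ^ 2 + x₁ ^ 2 ≤ 1) :
    t ^ 2 / (2 * (2 * a + 2) ^ 2) * ((x₀ - s₀) ^ 2 + (x₁ - s₁) ^ 2) ≤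
      v₀ * s₀ + v₁ * s₁ - (v₀ * x₀ + v₁ * x₁) := by
  obtain ⟨hc₁, hc₂⟩ := hc
  have ha : 0 ≤ a := by linarith
  have ht1 : t ^ 2 ≤ 1 := by nlinarith [sq_nonneg x₁]
  have hgap : ((x₀ - a - v₀) ^ 2 + (x₁ - v₁) ^ 2) / 2 ≤
      v₀ * s₀ + v₁ * s₁ - (v₀ * x₀ + v₁ * x₁) := by nlinarith
  refine le_trans ?_ hgap
  rcases lt_or_ge 0 v₀ with hpos | hneg
  · have hle : v₀ * (s₀ - c) + v₁ * s₁ ≤ 1 := by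
      nlinarith [sq_nonneg (v₀ - (s₀ - c)), sq_nonneg (v₁ - s₁)]
    have hca : c = a := by
      refine le_antisymm hc₂ (le_of_mul_le_mul_left ?_ hpos)
      nlinarith
    subst hca
    have hdist : (s₀ - c - v₀) ^ 2 + (s₁ - v₁) ^ 2 ≤ 0 := by nlinarith
    have h₀ : s₀ - c - v₀ = 0 := pow_eq_zero_iff two_ne_zero |>.1
      (by nlinarith [sq_nonneg (s₀ - c - v₀), sq_nonneg (s₁ - v₁)])
    have h₁ : s₁ - v₁ = 0 := pow_eq_zero_iff two_ne_zero |>.1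
      (by nlinarith [sq_nonneg (s₀ - c - v₀), sq_nonneg (s₁ - v₁)])
    obtain rfl : s₀ = c + v₀ := by linarith
    obtain rfl : s₁ = v₁ := by linarith
    have hA : t ^ 2 / (2 * (2 * c + 2) ^ 2) ≤ 1 / 2 := by
      rw [div_le_div_iff₀ (by positivity) two_pos]
      nlinarith
    have := mul_le_mul_of_nonneg_right hA
      (by positivity : 0 ≤ (x₀ - (c + v₀)) ^ 2 + (x₁ - s₁) ^ 2)
    linarith
  · have hdiam : (x₀ - s₀) ^ 2 + (x₁ - s₁) ^ 2 ≤ (2 * a + 2) ^ 2 := by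
      have hcross : (x₀ - a - (s₀ - c)) ^ 2 + (x₁ - s₁) ^ 2 ≤ 4 := by
        nlinarith [sq_nonneg (x₀ - a + (s₀ - c)), sq_nonneg (x₁ + s₁)]
      have habs : x₀ - a - (s₀ - c) ≤ 2 := by nlinarith [sq_nonneg (x₁ - s₁)]
      nlinarith
    have hfar : t ^ 2 ≤ (x₀ - a - v₀) ^ 2 + (x₁ - v₁) ^ 2 := by nlinarith [sq_nonneg (x₁ - v₁)]
    calc t ^ 2 / (2 * (2 * a + 2) ^ 2) * ((x₀ - s₀) ^ 2 + (x₁ - s₁) ^ 2)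
        ≤ t ^ 2 / (2 * (2 * a + 2) ^ 2) * (2 * a + 2) ^ 2 := by gcongr
      _ = t ^ 2 / 2 := by field_simp
      _ ≤ _ := by linarith

/-- **The stadium satisfies local dual sharpness (without being uniformly convex).**
Let `C_stad(a) = ([-a,a] × {0}) + B₂(0,1) ⊆ ℝ²` and let `M` be a nonempty compact
subset of the open right semicircle `Γ_a⁺`. Then for any fixed LMO atom-selection
rule, local dual sharpness holds around `M` with power `q = 2`. -/
theorem stadium_local_dual_sharpness
    {a : ℝ} (ha : 0 < a)
    {Cstad : Set (EuclideanSpace ℝ (Fin 2))}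
    (hCstad : Cstad =
      {y : EuclideanSpace ℝ (Fin 2) | y 0 ∈ Set.Icc (-a) a ∧ y 1 = 0} +
        Metric.closedBall (0 : EuclideanSpace ℝ (Fin 2)) 1)
    {M : Set (EuclideanSpace ℝ (Fin 2))}
    (hMne : M.Nonempty) (hMcomp : IsCompact M)
    (hMsub : M ⊆ {p : EuclideanSpace ℝ (Fin 2) |
      ∃ θ : ℝ, -(Real.pi / 2) < θ ∧ θ < Real.pi / 2 ∧
        p 0 = a + Real.cos θ ∧ p 1 = Real.sin θ})
    {lmo : EuclideanSpace ℝ (Fin 2) → EuclideanSpace ℝ (Fin 2)}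
    (hlmo : ∀ g, lmo g ∈ Cstad ∧ ∀ y ∈ Cstad, ⟪g, lmo g⟫ ≤ ⟪g, y⟫) :
    ∃ A > (0 : ℝ), ∃ ρ > (0 : ℝ), ∀ x ∈ Cstad, Metric.infDist x M < ρ →
      ∀ g : EuclideanSpace ℝ (Fin 2),
        A * ‖g‖ * ‖x - lmo g‖ ^ 2 ≤ ⟪g, x - lmo g⟫ := by
  obtain ⟨p, hpM, hpmin⟩ := hMcomp.exists_isMinOn hMne
    (f := fun p : EuclideanSpace ℝ (Fin 2) => p 0) (by fun_prop)
  obtain ⟨δ, hδ, hMδ⟩ : ∃ δ > 0, ∀ q ∈ M, a + δ ≤ q 0 := by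
    obtain ⟨θ, hθ₁, hθ₂, hp, -⟩ := hMsub hpM
    exact ⟨Real.cos θ, Real.cos_pos_of_mem_Ioo ⟨hθ₁, hθ₂⟩, fun q hq => hp ▸ hpmin hq⟩
  refine ⟨(δ / 2) ^ 2 / (2 * (2 * a + 2) ^ 2), by positivity, δ / 2, by positivity, ?_⟩
  intro x hx hxM g
  subst hCstad
  obtain ⟨q, hqM, hxq⟩ := (Metric.infDist_lt_iff hMne).1 hxM
  have hxt : δ / 2 ≤ x 0 - a := by
    have hcoord := (PiLp.norm_apply_le (x - q) 0).trans_lt (dist_eq_norm x q ▸ hxq)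
    rw [Real.norm_eq_abs, PiLp.sub_apply] at hcoord
    linarith [(abs_lt.1 hcoord).1, hMδ q hqM]
  have hxcap : (x 0 - a) ^ 2 + x 1 ^ 2 ≤ 1 := by
    obtain ⟨c, hc, h⟩ := (mem_stadium_iff x).1 hx
    nlinarith [hc.2]
  obtain ⟨c, hc, hs⟩ := (mem_stadium_iff _).1 (hlmo g).1
  rcases eq_or_ne g 0 with rfl | hg
  · simp
  have hG : 0 < ‖g‖ := norm_pos_iff.2 hg
  have hGsq : ‖g‖ ^ 2 = g 0 ^ 2 + g 1 ^ 2 := by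
    rw [EuclideanSpace.real_norm_sq_eq, Fin.sum_univ_two]
  have hinner (y : EuclideanSpace ℝ (Fin 2)) :
      ⟪g, y⟫ = -‖g‖ * (-g 0 / ‖g‖ * y 0 + -g 1 / ‖g‖ * y 1) := by
    rw [PiLp.inner_apply, Fin.sum_univ_two]
    simp only [RCLike.inner_apply, conj_trivial]
    field_simp
    ring
  have hv : (-g 0 / ‖g‖) ^ 2 + (-g 1 / ‖g‖) ^ 2 = 1 := by
    field_simp
    linarith
  have hmax := (hlmo g).2 !₂[a + -g 0 / ‖g‖, -g 1 / ‖g‖]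
    ((mem_stadium_iff _).2 ⟨a, ⟨by linarith, le_rfl⟩, by simpa using hv.le⟩)
  rw [hinner, hinner, neg_mul, neg_mul, neg_le_neg_iff, mul_le_mul_iff_right₀ hG] at hmax
  have key := stadium_sharpness_of_unit (half_pos hδ) hv hc hs hmax hxt hxcap
  rw [inner_sub_right, hinner, hinner, EuclideanSpace.real_norm_sq_eq, Fin.sum_univ_two,
    PiLp.sub_apply, PiLp.sub_apply]
  linarith [mul_le_mul_of_nonneg_left key hG.le]
end

section
/- (The truncated disk satisfies local dual sharpness without being uniformly convex) Let 0 < b < 1, let C_tr(b) = B_2(0, 1) ∩ {x ∈ ℝ² : x_1 ≤ b} be the truncated unit disk, and set h = √(1 − b²). Let M be any nonempty compact subset of the lower open arc Γ_b⁻ = {(x_1, x_2) ∈ ∂B_2(0,1) : x_2 < −h}. Then C_tr(b), with any fixed deterministic LMO atom-selection rule, satisfies local dual sharpness around M with power q = 2, i.e., there exist A > 0 and ρ > 0 such that for every x ∈ C_tr(b) with dist(x, M) < ρ, every g ∈ ℝ², and the selected atom s ∈ argmin_{y∈C_tr(b)} ⟨g, y⟩, one has A‖g‖‖x − s‖² ≤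 ⟨g, x − s⟩. -/
open scoped RealInnerProductSpace
open Filter

/-- Karush–Kuhn–Tucker multipliers, in coordinates, for a maximiser `(s₀, s₁)` of a linear
functional over the unit disk truncated at `y₀ ≤ b`. -/
lemma exists_multipliers_truncated_disk {b n₀ n₁ s₀ s₁ : ℝ} (hb0 : 0 < b) (hb1 : b < 1)
    (hs : s₀ ^ 2 + s₁ ^ 2 ≤ 1) (hsb : s₀ ≤ b)
    (hmax : ∀ y₀ y₁ : ℝ, y₀ ^ 2 + y₁ ^ 2 ≤ 1 → y₀ ≤ b →
      n₀ * y₀ + n₁ * y₁ ≤ n₀ * s₀ + n₁ * s₁) :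
    ∃ α β : ℝ, 0 ≤ α ∧ 0 ≤ β ∧ n₀ = α * s₀ + β ∧ n₁ = α * s₁ ∧
      α * (s₀ ^ 2 + s₁ ^ 2) = α ∧ β * s₀ = β * b := by
  -- A vector of the disk whose inner product with a unit vector is at least one equals it.
  have key : ∀ u v : ℝ, u ^ 2 + v ^ 2 = 1 → 1 ≤ u * s₀ + v * s₁ → s₀ = u ∧ s₁ = v := by
    intro u v huv h
    have h0 : (s₀ - u) ^ 2 + (s₁ - v) ^ 2 ≤ 0 := by nlinarith
    constructor
    · have : (s₀ - u) ^ 2 = 0 := by nlinarith [sq_nonneg (s₀ - u), sq_nonneg (s₁ - v)]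
      linarith [pow_eq_zero_iff (two_ne_zero) |>.1 this]
    · have : (s₁ - v) ^ 2 = 0 := by nlinarith [sq_nonneg (s₀ - u), sq_nonneg (s₁ - v)]
      linarith [pow_eq_zero_iff (two_ne_zero) |>.1 this]
  set r := Real.sqrt (n₀ ^ 2 + n₁ ^ 2) with hr
  have hr0 : 0 ≤ r := Real.sqrt_nonneg _
  have hr2 : r ^ 2 = n₀ ^ 2 + n₁ ^ 2 := Real.sq_sqrt (by positivity)
  rcases hr0.eq_or_lt with hz | hrpos
  · have h : n₀ ^ 2 + n₁ ^ 2 = 0 := by rw [← hr2, ← hz]; norm_num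
    have h0 : n₀ = 0 := by nlinarith [sq_nonneg n₀, sq_nonneg n₁]
    have h1 : n₁ = 0 := by nlinarith [sq_nonneg n₀, sq_nonneg n₁]
    exact ⟨0, 0, by simp [h0, h1]⟩
  rcases le_or_gt n₀ (b * r) with hle | hgt
  · have hu : (n₀ / r) ^ 2 + (n₁ / r) ^ 2 = 1 := by field_simp; linarith
    have hm := hmax (n₀ / r) (n₁ / r) hu.le (by rwa [div_le_iff₀ hrpos])
    have e : n₀ * (n₀ / r) + n₁ * (n₁ / r) = r := by field_simp; linarith
    have h1 : 1 ≤ n₀ / r * s₀ + n₁ / r * s₁ := by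
      have : n₀ / r * s₀ + n₁ / r * s₁ = (n₀ * s₀ + n₁ * s₁) / r := by ring
      rw [this, le_div_iff₀ hrpos]; linarith
    obtain ⟨e0, e1⟩ := key _ _ hu h1
    refine ⟨r, 0, hr0, le_rfl, ?_, ?_, ?_, by ring⟩
    · rw [e0]; field_simp; ring
    · rw [e1]; field_simp
    · rw [e0, e1, hu, mul_one]
  · have hn0 : 0 < n₀ := lt_trans (by positivity) hgt
    set h := Real.sqrt (1 - b ^ 2) with hh
    have hb2 : 0 < 1 - b ^ 2 := by nlinarith
    have hpos : 0 < h := Real.sqrt_pos.2 hb2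
    have hsq : h ^ 2 = 1 - b ^ 2 := Real.sq_sqrt hb2.le
    obtain ⟨σ, hσ, hσn⟩ : ∃ σ : ℝ, σ ^ 2 = 1 ∧ |n₁| = σ * n₁ := by
      rcases abs_choice n₁ with e | e
      · exact ⟨1, by norm_num, by linarith⟩
      · exact ⟨-1, by norm_num, by linarith⟩
    have hc : b ^ 2 + (σ * h) ^ 2 = 1 := by rw [mul_pow, hσ, hsq]; ring
    have hn1 : n₁ = |n₁| / h * (σ * h) := by
      field_simp; rw [hσn]; linear_combination -n₁ * hσ
    set α := |n₁| / h with hα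
    have hα0 : 0 ≤ α := by positivity
    have hαn : (α * h) ^ 2 = n₁ ^ 2 := by rw [hα, div_mul_cancel₀ _ hpos.ne', sq_abs]
    have hβ : 0 < n₀ - α * b := by
      have h1 : (b * r) ^ 2 < n₀ ^ 2 := by gcongr
      have h2 : (α * b) ^ 2 * h ^ 2 < n₀ ^ 2 * h ^ 2 := by
        nlinarith
      have h3 : α * b < n₀ :=
        lt_of_pow_lt_pow_left₀ 2 hn0.le (lt_of_mul_lt_mul_right h2 (by positivity))
      linarith
    have hm := hmax b (σ * h) hc.le le_rfl
    have hcs : b * s₀ + σ * h * s₁ ≤ 1 := by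
      nlinarith [sq_nonneg (b - s₀), sq_nonneg (σ * h - s₁)]
    have hm' : α * (1 - (b * s₀ + σ * h * s₁)) + (n₀ - α * b) * (b - s₀) ≤ 0 := by
      linear_combination hm - (σ * h - s₁) * hn1 - α * hc
    have p1 := mul_nonneg hα0 (sub_nonneg.2 hcs)
    have p2 := mul_nonneg hβ.le (sub_nonneg.2 hsb)
    have hs0 : s₀ = b := by
      have : (n₀ - α * b) * (b - s₀) = 0 := by linarith
      rcases mul_eq_zero.1 this with h | h <;> linarith
    have hs1 : α = 0 ∨ s₁ = σ * h := by
      have : α * (1 - (b * s₀ + σ * h * s₁)) = 0 := by linarith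
      rcases mul_eq_zero.1 this with h | h
      · exact Or.inl h
      · exact Or.inr (key _ _ hc (by linarith)).2
    refine ⟨α, n₀ - α * b, hα0, hβ.le, by rw [hs0]; ring, ?_, ?_, by rw [hs0]⟩
    · rcases hs1 with e | e
      · rw [hn1, e]; ring
      · rw [e]; exact hn1
    · rcases hs1 with e | e
      · rw [e]; ring
      · rw [hs0, e, hc, mul_one]

/-- **The truncated disk satisfies local dual sharpness (without being uniformly convex).**
Let `C_tr(b) = B₂(0,1) ∩ {x₁ ≤ b}` with `0 < b < 1`, `h = √(1-b²)`, and let `M` be a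
nonempty compact subset of the lower open arc `{x ∈ ∂B₂(0,1) : x₂ < -h}`. Then for
any fixed LMO atom-selection rule, local dual sharpness holds around `M` with
power `q = 2`. -/
theorem truncated_disk_local_dual_sharpness
    {b : ℝ} (hb0 : 0 < b) (hb1 : b < 1)
    {Ctr : Set (EuclideanSpace ℝ (Fin 2))}
    (hCtr : Ctr =
      Metric.closedBall (0 : EuclideanSpace ℝ (Fin 2)) 1 ∩
        {y : EuclideanSpace ℝ (Fin 2) | y 0 ≤ b})
    {M : Set (EuclideanSpace ℝ (Fin 2))}
    (hMne : M.Nonempty) (hMcomp : IsCompact M)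
    (hMsub : M ⊆ {p : EuclideanSpace ℝ (Fin 2) |
      ‖p‖ = 1 ∧ p 1 < -Real.sqrt (1 - b ^ 2)})
    {lmo : EuclideanSpace ℝ (Fin 2) → EuclideanSpace ℝ (Fin 2)}
    (hlmo : ∀ g, lmo g ∈ Ctr ∧ ∀ y ∈ Ctr, ⟪g, lmo g⟫ ≤ ⟪g, y⟫) :
    ∃ A > (0 : ℝ), ∃ ρ > (0 : ℝ), ∀ x ∈ Ctr, Metric.infDist x M < ρ →
      ∀ g : EuclideanSpace ℝ (Fin 2),
        A * ‖g‖ * ‖x - lmo g‖ ^ 2 ≤ ⟪g, x - lmo g⟫ := by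
  subst hCtr
  have inner_eq : ∀ u v : EuclideanSpace ℝ (Fin 2), ⟪u, v⟫ = u 0 * v 0 + u 1 * v 1 := by
    intro u v
    simp [PiLp.inner_apply, Fin.sum_univ_two, mul_comm]
  have norm_sq : ∀ u : EuclideanSpace ℝ (Fin 2), ‖u‖ ^ 2 = u 0 ^ 2 + u 1 ^ 2 := by
    intro u
    rw [← real_inner_self_eq_norm_sq, inner_eq]; ring
  have coord_le_norm : ∀ u : EuclideanSpace ℝ (Fin 2), u 0 ≤ ‖u‖ := fun u =>
    (le_abs_self _).trans (PiLp.norm_apply_le u 0)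
  obtain ⟨p, hpM, hp⟩ := hMcomp.exists_isMaxOn hMne
    (f := fun q : EuclideanSpace ℝ (Fin 2) => q 0) (by fun_prop)
  have hpb : p 0 < b := by
    obtain ⟨hp1, hp2⟩ := hMsub hpM
    have h2 : 0 ≤ 1 - b ^ 2 := by nlinarith
    have h3 := Real.sq_sqrt h2
    have h4 := Real.sqrt_nonneg (1 - b ^ 2)
    have h5 := norm_sq p
    rw [hp1] at h5
    refine lt_of_pow_lt_pow_left₀ 2 hb0.le ?_
    nlinarith
  obtain ⟨δ, hδ, hδb⟩ : ∃ δ > 0, p 0 + 2 * δ = b := ⟨(b - p 0) / 2, by linarith, by ring⟩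
  refine ⟨min (1 / 2) (δ / 4), by positivity, δ, hδ, ?_⟩
  rintro x ⟨hx1, -⟩ hxM g
  obtain ⟨q, hqM, hq⟩ := (Metric.infDist_lt_iff hMne).1 hxM
  have hxδ : x 0 ≤ b - δ := by
    have h1 : q 0 ≤ p 0 := hp hqM
    have h2 := coord_le_norm (x - q)
    rw [← dist_eq_norm] at h2
    simp only [PiLp.sub_apply] at h2
    linarith
  obtain ⟨⟨hs1, hsb⟩, hmin⟩ := hlmo g
  set s := lmo g
  rw [mem_closedBall_zero_iff] at hx1 hs1
  obtain ⟨α, β, hα, hβ, hg0, hg1, hαs, hβs⟩ :=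
    exists_multipliers_truncated_disk (n₀ := -g 0) (n₁ := -g 1) hb0 hb1
      (s₀ := s 0) (s₁ := s 1) (by rw [← norm_sq]; exact pow_le_one₀ (norm_nonneg _) hs1) hsb
      (by
        intro y₀ y₁ hy hyb
        have hy1 : ‖!₂[y₀, y₁]‖ ≤ 1 := by
          rw [← sq_le_one_iff₀ (norm_nonneg _), norm_sq]
          simpa using hy
        have h := hmin !₂[y₀, y₁] ⟨mem_closedBall_zero_iff.2 hy1, by simpa using hyb⟩
        rw [inner_eq, inner_eq] at h
        simp at h
        linarith)
  have hg : -g = α • s + β • EuclideanSpace.single (0 : Fin 2) (1 : ℝ) := by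
    ext i
    fin_cases i <;> simp [hg0, hg1]
  have hgn : ‖g‖ ≤ α + β := by
    rw [← norm_neg, hg]
    refine (norm_add_le _ _).trans ?_
    rw [norm_smul, norm_smul, Real.norm_of_nonneg hα, Real.norm_of_nonneg hβ]
    simp only [PiLp.norm_single, norm_one, mul_one]
    nlinarith
  have hd4 : ‖x - s‖ ^ 2 ≤ 4 := by
    nlinarith [norm_sub_le x s, norm_nonneg (x - s)]
  have hx2 : x 0 ^ 2 + x 1 ^ 2 ≤ 1 := by
    rw [← norm_sq]; exact pow_le_one₀ (norm_nonneg _) hx1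
  have hin : α * (‖x - s‖ ^ 2 / 2) + β * δ ≤ ⟪g, x - s⟫ := by
    have e : ⟪g, x - s⟫ = α * (s 0 * (s 0 - x 0) + s 1 * (s 1 - x 1)) + β * (s 0 - x 0) := by
      rw [inner_eq]
      simp only [PiLp.sub_apply]
      linear_combination (s 0 - x 0) * hg0 + (s 1 - x 1) * hg1
    rw [e, norm_sq]
    simp only [PiLp.sub_apply]
    have h1 := mul_le_mul_of_nonneg_left hxδ hβ
    have h2 := mul_le_mul_of_nonneg_left hx2 hα
    nlinarith
  refine le_trans ?_ hin
  set d := ‖x - s‖ ^ 2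
  have hd : 0 ≤ d := sq_nonneg _
  set A := min (1 / 2) (δ / 4)
  have hA : 0 ≤ A := by positivity
  calc A * ‖g‖ * d ≤ A * (α + β) * d := by gcongr
    _ = α * (A * d) + β * (A * d) := by ring
    _ ≤ α * (d / 2) + β * δ := by
      have h1 : A * d ≤ 1 / 2 * d := by gcongr; exact min_le_left _ _
      have h2 : A * d ≤ δ / 4 * 4 := by gcongr; exact min_le_right _ _
      gcongr <;> linarith
end
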